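/- arXiv:1611.09297 — 4 statements merged into one kernel-verified Lean document; each statement's English description precedes it below -/
import Mathlib

section
/- Let (S,R,C) be an extended triangular system. Then (S,R,C) is maximal if and only if for every x ∈ [0,1] the following hold, where i ≼_x j means x ∈ S_{i,j}, A_x := {i ∈ ℕ : x ∈ C_i} and B_x := {i ∈ ℕ : x ∈ R_i}: (i) ≼_x is a linear (total) order on ℕ; (ii) A_x ∪ B_x = ℕ; and (iii) either A_x has no ≼_x-least element and B_x has no ≼_x-greatest element, or A_x has a ≼_x-least element, B_x has a ≼_x-greatest element, and these two elements are equal. -/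
open Set

namespace Orr

/-- A Borel subset of `[0,1]`. -/
def BorelIn01 (A : Set ℝ) : Prop := A ⊆ Set.Icc (0:ℝ) 1 ∧ MeasurableSet A

/-- A triangular system: a family of Borel subsets of `[0,1]` with `S_{i,i} = [0,1]`,
`S_{i,j} ∩ S_{j,i} = ∅` for `i ≠ j`, and `S_{i,j} ∩ S_{j,k} ⊆ S_{i,k}`. -/
def IsTriSys (S : ℕ → ℕ → Set ℝ) : Prop :=
  (∀ i j, BorelIn01 (S i j)) ∧
  (∀ i, S i i = Set.Icc (0:ℝ) 1) ∧
  (∀ i j, i ≠ j → S i j ∩ S j i = ∅) ∧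
  (∀ i j k, S i j ∩ S j k ⊆ S i k)

/-- An extended triangular system. -/
def IsETS (S : ℕ → ℕ → Set ℝ) (R C : ℕ → Set ℝ) : Prop :=
  IsTriSys S ∧ (∀ i, BorelIn01 (R i)) ∧ (∀ j, BorelIn01 (C j)) ∧
  (∀ i j, C i ∩ S i j ⊆ C j) ∧ (∀ i j, S i j ∩ R j ⊆ R i) ∧ (∀ i j, R i ∩ C j ⊆ S i j)

/-- A maximal extended triangular system: no enlargement is an extended triangular system
other than itself. -/
def IsMaxETS (S : ℕ → ℕ → Set ℝ) (R C : ℕ → Set ℝ) : Prop :=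
  IsETS S R C ∧ ∀ (S' : ℕ → ℕ → Set ℝ) (R' C' : ℕ → Set ℝ), IsETS S' R' C' →
    (∀ i j, S i j ⊆ S' i j) → (∀ i, R i ⊆ R' i) → (∀ j, C j ⊆ C' j) →
    (∀ i j, S' i j = S i j) ∧ (∀ i, R' i = R i) ∧ (∀ j, C' j = C j)

/-- The trace of an extended triangular system at a point: a partial order `r` with a lower
set `B` and an upper set `A` such that every element of `B` is below every element of `A`. -/
structure IsOrderCut {α : Type*} (r : α → α → Prop) (B A : α → Prop) : Prop where
  refl : ∀ i, r i i
  antisymm : ∀ i j, r i j → r j i → i = j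
  trans : ∀ i j k, r i j → r j k → r i k
  upper : ∀ i j, A i → r i j → A j
  lower : ∀ i j, r i j → B j → B i
  le : ∀ i j, B i → A j → r i j

namespace IsOrderCut

variable {α : Type*} {r : α → α → Prop} {B A : α → Prop}

/-- Declare `i` to be below `j` in an order cut in which `j` is not below `i`. -/
theorem adjoin_le (h : IsOrderCut r B A) {i j : α} (hji : ¬ r j i) :
    IsOrderCut (fun a b => r a b ∨ (r a i ∧ r j b)) (fun a => B a ∨ (r a i ∧ B j))
      (fun a => A a ∨ (A i ∧ r j a)) := by
  obtain ⟨hr, ha, ht, hu, hl, hle⟩ := h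
  constructor <;> grind

/-- An element outside both parts of a totally ordered cut can be put in the upper part. -/
theorem adjoin_upper (h : IsOrderCut r B A) (htot : ∀ i j, r i j ∨ r j i) {i : α}
    (hB : ¬ B i) : IsOrderCut r B (fun a => A a ∨ r i a) := by
  obtain ⟨hr, ha, ht, hu, hl, hle⟩ := h
  constructor <;> grind

/-- The least element of the upper part can be put in the lower part. -/
theorem insert_lower (h : IsOrderCut r B A) (hcov : ∀ i, A i ∨ B i) {m : α}
    (hmin : ∀ i, A i → r m i) : IsOrderCut r (fun a => B a ∨ a = m) A := by
  obtain ⟨hr, ha, ht, hu, hl, hle⟩ := h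
  constructor <;> grind

/-- The greatest element of the lower part can be put in the upper part. -/
theorem insert_upper (h : IsOrderCut r B A) (hcov : ∀ i, A i ∨ B i) {m : α}
    (hmax : ∀ i, B i → r i m) : IsOrderCut r B (fun a => A a ∨ a = m) := by
  obtain ⟨hr, ha, ht, hu, hl, hle⟩ := h
  constructor <;> grind

end IsOrderCut

theorem BorelIn01.union_singleton_inter {A : Set ℝ} (hA : BorelIn01 A) {x : ℝ}
    (hx : x ∈ Set.Icc (0:ℝ) 1) (p : Prop) : BorelIn01 (A ∪ {y | y = x ∧ p}) := by
  refine ⟨union_subset hA.1 ?_, hA.2.union ?_⟩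
  · rintro y ⟨rfl, -⟩
    exact hx
  · by_cases hp : p <;> simp [hp]

section Trace

variable {S : ℕ → ℕ → Set ℝ} {R C : ℕ → Set ℝ}

theorem IsETS.isOrderCut (h : IsETS S R C) {x : ℝ} (hx : x ∈ Set.Icc (0:ℝ) 1) :
    IsOrderCut (fun i j => x ∈ S i j) (fun i => x ∈ R i) (fun i => x ∈ C i) := by
  obtain ⟨⟨-, hd, ha, ht⟩, -, -, hC, hR, hRC⟩ := h
  refine ⟨fun i => hd i ▸ hx, fun i j hij hji => ?_, fun i j k hij hjk => ht i j k ⟨hij, hjk⟩,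
    fun i j hi hij => hC i j ⟨hi, hij⟩, fun i j hij hj => hR i j ⟨hij, hj⟩,
    fun i j hi hj => hRC i j ⟨hi, hj⟩⟩
  by_contra hne
  exact (ha i j hne).subset ⟨hij, hji⟩

theorem isETS_iff_isOrderCut :
    IsETS S R C ↔ (∀ i j, BorelIn01 (S i j)) ∧ (∀ i, BorelIn01 (R i)) ∧
      (∀ j, BorelIn01 (C j)) ∧ ∀ x ∈ Set.Icc (0:ℝ) 1,
        IsOrderCut (fun i j => x ∈ S i j) (fun i => x ∈ R i) (fun i => x ∈ C i) := by
  refine ⟨fun h => ⟨h.1.1, h.2.1, h.2.2.1, fun x hx => h.isOrderCut hx⟩, ?_⟩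
  rintro ⟨hS, hR, hC, h⟩
  refine ⟨⟨hS, fun i => ?_, fun i j hij => ?_, fun i j k x hx => ?_⟩, hR, hC,
    fun i j x hx => ?_, fun i j x hx => ?_, fun i j x hx => ?_⟩
  · exact (hS i i).1.antisymm fun x hx => (h x hx).refl i
  · refine eq_empty_of_forall_notMem fun x hx => hij ?_
    exact (h x ((hS i j).1 hx.1)).antisymm i j hx.1 hx.2
  · exact (h x ((hS i j).1 hx.1)).trans i j k hx.1 hx.2
  · exact (h x ((hC i).1 hx.1)).upper i j hx.1 hx.2
  · exact (h x ((hS i j).1 hx.1)).lower i j hx.1 hx.2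
  · exact (h x ((hR i).1 hx.1)).le i j hx.1 hx.2

/-- A maximal extended triangular system has a maximal trace at every point. -/
theorem IsMaxETS.trace_maximal (h : IsMaxETS S R C) {x : ℝ} (hx : x ∈ Set.Icc (0:ℝ) 1)
    {r : ℕ → ℕ → Prop} {B A : ℕ → Prop} (hcut : IsOrderCut r B A)
    (hr : ∀ i j, x ∈ S i j → r i j) (hB : ∀ i, x ∈ R i → B i) (hA : ∀ i, x ∈ C i → A i) :
    (∀ i j, r i j → x ∈ S i j) ∧ (∀ i, B i → x ∈ R i) ∧ (∀ i, A i → x ∈ C i) := by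
  obtain ⟨hS, hR, hC, hpt⟩ := isETS_iff_isOrderCut.1 h.1
  have hETS : IsETS (fun i j => S i j ∪ {y | y = x ∧ r i j})
      (fun i => R i ∪ {y | y = x ∧ B i}) (fun i => C i ∪ {y | y = x ∧ A i}) := by
    refine isETS_iff_isOrderCut.2 ⟨fun i j => (hS i j).union_singleton_inter hx _,
      fun i => (hR i).union_singleton_inter hx _, fun i => (hC i).union_singleton_inter hx _,
      fun y hy => ?_⟩
    by_cases hyx : y = x
    · subst hyx
      simpa [or_iff_right_of_imp (hr _ _), or_iff_right_of_imp (hB _),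
        or_iff_right_of_imp (hA _)] using hcut
    · simpa [hyx] using hpt y hy
  obtain ⟨eS, eR, eC⟩ := h.2 _ _ _ hETS (fun _ _ => subset_union_left)
    (fun _ => subset_union_left) (fun _ => subset_union_left)
  exact ⟨fun i j hij => (eS i j).subset (Or.inr ⟨rfl, hij⟩),
    fun i hi => (eR i).subset (Or.inr ⟨rfl, hi⟩), fun i hi => (eC i).subset (Or.inr ⟨rfl, hi⟩)⟩

end Trace

/-- An extended triangular system `(S,R,C)` is maximal iff for every
`x ∈ [0,1]` the induced relation `i ≼_x j ↔ x ∈ S_{i,j}` is a linear order, the induced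
cut satisfies `A_x ∪ B_x = ℕ`, and either `A_x` has no least element and `B_x` no greatest
element, or `min A_x` and `max B_x` both exist and coincide. -/
theorem statement8 (S : ℕ → ℕ → Set ℝ) (R C : ℕ → Set ℝ) (hETS : IsETS S R C) :
    IsMaxETS S R C ↔
      ∀ x ∈ Set.Icc (0:ℝ) 1,
        ((∀ i : ℕ, x ∈ S i i) ∧
         (∀ i j : ℕ, x ∈ S i j → x ∈ S j i → i = j) ∧
         (∀ i j k : ℕ, x ∈ S i j → x ∈ S j k → x ∈ S i k) ∧
         (∀ i j : ℕ, x ∈ S i j ∨ x ∈ S j i)) ∧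
        (∀ i : ℕ, x ∈ C i ∨ x ∈ R i) ∧
        (((¬ ∃ m : ℕ, x ∈ C m ∧ ∀ i : ℕ, x ∈ C i → x ∈ S m i) ∧
          (¬ ∃ m : ℕ, x ∈ R m ∧ ∀ i : ℕ, x ∈ R i → x ∈ S i m)) ∨
         (∃ m : ℕ, (x ∈ C m ∧ ∀ i : ℕ, x ∈ C i → x ∈ S m i) ∧
                   (x ∈ R m ∧ ∀ i : ℕ, x ∈ R i → x ∈ S i m))) := by
  constructor
  · intro h x hx
    have hc := hETS.isOrderCut hx
    have htot : ∀ i j, x ∈ S i j ∨ x ∈ S j i := by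
      intro i j
      by_contra! hn
      exact hn.1 ((h.trace_maximal hx (hc.adjoin_le hn.2) (fun _ _ => Or.inl)
        (fun _ => Or.inl) (fun _ => Or.inl)).1 i j (Or.inr ⟨hc.refl i, hc.refl j⟩))
    have hcov : ∀ i, x ∈ C i ∨ x ∈ R i := by
      intro i
      by_contra! hn
      exact hn.1 ((h.trace_maximal hx (hc.adjoin_upper htot hn.2) (fun _ _ => id)
        (fun _ => id) (fun _ => Or.inl)).2.2 i (Or.inr (hc.refl i)))
    refine ⟨⟨hc.refl, hc.antisymm, hc.trans, htot⟩, hcov, ?_⟩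
    by_cases hmin : ∃ m, x ∈ C m ∧ ∀ i, x ∈ C i → x ∈ S m i
    · obtain ⟨m, hm, hle⟩ := hmin
      have hmR := (h.trace_maximal hx (hc.insert_lower hcov hle) (fun _ _ => id)
        (fun _ => Or.inl) (fun _ => id)).2.1 m (Or.inr rfl)
      exact Or.inr ⟨m, ⟨hm, hle⟩, hmR, fun i hi => hc.le i m hi hm⟩
    · refine Or.inl ⟨hmin, ?_⟩
      rintro ⟨m, hm, hge⟩
      have hmC := (h.trace_maximal hx (hc.insert_upper hcov hge) (fun _ _ => id)
        (fun _ => id) (fun _ => Or.inl)).2.2 m (Or.inr rfl)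
      exact hmin ⟨m, hmC, fun i hi => hc.le m i hm hi⟩
  · intro h
    refine ⟨hETS, fun S' R' C' h' hS hR hC => ?_⟩
    obtain ⟨bS, bR, bC, hpt⟩ := isETS_iff_isOrderCut.1 h'
    have key : ∀ i j, S' i j ⊆ S i j := by
      intro i j x hx'
      have hx := (bS i j).1 hx'
      obtain ⟨⟨hrefl, -, -, htot⟩, -, -⟩ := h x hx
      rcases htot i j with hij | hji
      · exact hij
      · obtain rfl := (hpt x hx).antisymm i j hx' (hS j i hji)
        exact hrefl i
    refine ⟨fun i j => (key i j).antisymm (hS i j), fun i => Subset.antisymm ?_ (hR i),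
      fun i => Subset.antisymm ?_ (hC i)⟩
    · intro x hx'
      have hx := (bR i).1 hx'
      obtain ⟨⟨-, hanti, -, -⟩, hcov, hend⟩ := h x hx
      rcases hcov i with hi | hi
      · have hle : ∀ j, x ∈ C j → x ∈ S i j := fun j hj =>
          key i j ((hpt x hx).le i j hx' (hC j hj))
        rcases hend with ⟨hmin, -⟩ | ⟨m, ⟨hm, hmle⟩, hmR, -⟩
        · exact absurd ⟨i, hi, hle⟩ hmin
        · exact hanti i m (hle m hm) (hmle i hi) ▸ hmR
      · exact hi
    · intro x hx'
      have hx := (bC i).1 hx'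
      obtain ⟨⟨-, hanti, -, -⟩, hcov, hend⟩ := h x hx
      rcases hcov i with hi | hi
      · exact hi
      · have hge : ∀ j, x ∈ R j → x ∈ S j i := fun j hj =>
          key j i ((hpt x hx).le j i (hR j hj) hx')
        rcases hend with ⟨-, hmax⟩ | ⟨m, ⟨hmC, -⟩, hm, hmge⟩
        · exact absurd ⟨i, hi, hge⟩ hmax
        · exact hanti i m (hmge i hi) (hge m hm) ▸ hmC

end Orr
end

section
/- Every extended triangular system can be enlarged to a maximal extended triangular system: if (S,R,C) is an extended triangular system, then there is a maximal extended triangular system (S',R',C') (all of whose constituent sets are Borel) with S_{i,j} ⊆ S'_{i,j}, R_i ⊆ R'_i and C_j ⊆ C'_j for all i,j ∈ ℕ. -/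
open Set

namespace Orr

/-- A Borel family of preorders on `ℕ ∪ {*}`, indexed by the points of `[0,1]`, whose restrictions
to `ℕ` are antisymmetric. -/
structure IsPreorderFamily (T : Option ℕ → Option ℕ → Set ℝ) : Prop where
  borel : ∀ u v, BorelIn01 (T u v)
  refl : ∀ u, T u u = Icc (0:ℝ) 1
  trans : ∀ {u v w x}, x ∈ T u v → x ∈ T v w → x ∈ T u w
  antisymm : ∀ {i j : ℕ} {x}, x ∈ T (some i) (some j) → x ∈ T (some j) (some i) → i = j

/-- The relations on `ℕ ∪ {*}` encoding `(S, R, C)`: `R i` becomes `i ≤ *` and `C j` becomes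
`* ≤ j`. -/
def adjoin (S : ℕ → ℕ → Set ℝ) (R C : ℕ → Set ℝ) : Option ℕ → Option ℕ → Set ℝ
  | some i, some j => S i j
  | some i, none => R i
  | none, some j => C j
  | none, none => Icc 0 1

theorem IsETS.isPreorderFamily {S : ℕ → ℕ → Set ℝ} {R C : ℕ → Set ℝ} (h : IsETS S R C) :
    IsPreorderFamily (adjoin S R C) := by
  obtain ⟨⟨hS, hrefl, hanti, htrans⟩, hR, hC, hCS, hSR, hRC⟩ := h
  refine ⟨?_, ?_, ?_, ?_⟩
  · rintro (_ | i) (_ | j)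
    exacts [⟨subset_rfl, measurableSet_Icc⟩, hC j, hR i, hS i j]
  · rintro (_ | i)
    exacts [rfl, hrefl i]
  · rintro (_ | i) (_ | j) (_ | k) x hx hy
    exacts [hx, hy, (hC j).1 hx, hCS j k ⟨hx, hy⟩, hx, hRC i k ⟨hx, hy⟩, hSR i j ⟨hx, hy⟩,
      htrans i j k ⟨hx, hy⟩]
  · intro i j x hx hy
    by_contra hij
    exact (hanti i j hij).subset ⟨hx, hy⟩

theorem IsPreorderFamily.isETS {T : Option ℕ → Option ℕ → Set ℝ} (h : IsPreorderFamily T) :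
    IsETS (fun i j => T (some i) (some j)) (fun i => T (some i) none)
      (fun j => T none (some j)) :=
  ⟨⟨fun _ _ => h.borel _ _, fun _ => h.refl _,
      fun _ _ hij => eq_empty_of_forall_notMem fun _ hx => hij (h.antisymm hx.1 hx.2),
      fun _ _ _ _ hx => h.trans hx.1 hx.2⟩,
    fun _ => h.borel _ _, fun _ => h.borel _ _, fun _ _ _ hx => h.trans hx.1 hx.2,
    fun _ _ _ hx => h.trans hx.1 hx.2, fun _ _ _ hx => h.trans hx.1 hx.2⟩

/-- The transitive relations generated by `T` and the relation `p.1 ≤ p.2`. -/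
def insertRel (p : Option ℕ × Option ℕ) (T : Option ℕ → Option ℕ → Set ℝ) (u v : Option ℕ) :
    Set ℝ :=
  T u v ∪ (T u p.1 ∩ T p.2 v)

/-- The points at which imposing `p.1 ≤ p.2` violates antisymmetry. -/
def conflict (p : Option ℕ × Option ℕ) (T : Option ℕ → Option ℕ → Set ℝ) : Set ℝ :=
  ⋃ (i : ℕ) (j : ℕ) (_ : i ≠ j),
    insertRel p T (some i) (some j) ∩ insertRel p T (some j) (some i)

/-- Impose `p.1 ≤ p.2` at every point where this preserves antisymmetry. -/
def greedyStep (p : Option ℕ × Option ℕ) (T : Option ℕ → Option ℕ → Set ℝ) (u v : Option ℕ) :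
    Set ℝ :=
  T u v ∪ ((T u p.1 ∩ T p.2 v) \ conflict p T)

theorem IsPreorderFamily.greedyStep {T : Option ℕ → Option ℕ → Set ℝ} (h : IsPreorderFamily T)
    (p : Option ℕ × Option ℕ) : IsPreorderFamily (greedyStep p T) := by
  have hconflict : MeasurableSet (conflict p T) := by
    refine .iUnion fun i => .iUnion fun j => .iUnion fun _ => ?_
    exact ((h.borel _ _).2.union ((h.borel _ _).2.inter (h.borel _ _).2)).inter
      ((h.borel _ _).2.union ((h.borel _ _).2.inter (h.borel _ _).2))
  have hsub : ∀ u v, Orr.greedyStep p T u v ⊆ Icc 0 1 := fun u v =>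
    union_subset (h.borel _ _).1 fun x hx => (h.borel _ _).1 hx.1.1
  refine ⟨fun u v => ⟨hsub u v, ?_⟩, fun u => ?_, ?_, ?_⟩
  · exact (h.borel _ _).2.union (((h.borel _ _).2.inter (h.borel _ _).2).diff hconflict)
  · exact (hsub u u).antisymm ((h.refl u).symm.subset.trans subset_union_left)
  · rintro u v w x (hx | ⟨⟨hx, hx'⟩, hc⟩) (hy | ⟨⟨hy, hy'⟩, hc'⟩)
    · exact .inl (h.trans hx hy)
    · exact .inr ⟨⟨h.trans hx hy, hy'⟩, hc'⟩
    · exact .inr ⟨⟨hx, h.trans hx' hy⟩, hc⟩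
    · exact .inr ⟨⟨hx, hy'⟩, hc⟩
  · intro i j x hx hy
    by_cases hc : x ∈ conflict p T
    · exact h.antisymm (hx.resolve_right fun hx => hx.2 hc) (hy.resolve_right fun hy => hy.2 hc)
    · by_contra hij
      refine hc (mem_iUnion.2 ⟨i, mem_iUnion.2 ⟨j, mem_iUnion.2 ⟨hij, ?_⟩⟩⟩)
      exact ⟨hx.imp_right And.left, hy.imp_right And.left⟩

theorem IsPreorderFamily.mem_greedyStep {T M : Option ℕ → Option ℕ → Set ℝ}
    (h : IsPreorderFamily T) (hM : IsPreorderFamily M) (hTM : ∀ u v, T u v ⊆ M u v)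
    {a b : Option ℕ} {x : ℝ} (hx : x ∈ M a b) : x ∈ Orr.greedyStep (a, b) T a b := by
  have hx01 : x ∈ Icc (0:ℝ) 1 := (hM.borel a b).1 hx
  have hins : ∀ u v, x ∈ insertRel (a, b) T u v → x ∈ M u v := by
    rintro u v (hy | ⟨hy, hy'⟩)
    · exact hTM u v hy
    · exact hM.trans (hTM _ _ hy) (hM.trans hx (hTM _ _ hy'))
  refine .inr ⟨⟨(h.refl a).symm ▸ hx01, (h.refl b).symm ▸ hx01⟩, fun hc => ?_⟩
  simp only [conflict, mem_iUnion] at hc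
  obtain ⟨i, j, hij, hy, hy'⟩ := hc
  exact hij (hM.antisymm (hins _ _ hy) (hins _ _ hy'))

theorem IsPreorderFamily.iUnion {T : ℕ → Option ℕ → Option ℕ → Set ℝ}
    (h : ∀ n, IsPreorderFamily (T n)) (hmono : ∀ u v, Monotone fun n => T n u v) :
    IsPreorderFamily fun u v => ⋃ n, T n u v := by
  refine ⟨fun u v => ⟨iUnion_subset fun n => ((h n).borel u v).1,
    .iUnion fun n => ((h n).borel u v).2⟩, fun u => ?_, ?_, ?_⟩
  · simp only [(h _).refl, iUnion_const]
  · intro u v w x hx hy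
    obtain ⟨m, hm⟩ := mem_iUnion.1 hx
    obtain ⟨n, hn⟩ := mem_iUnion.1 hy
    exact mem_iUnion.2 ⟨max m n, (h _).trans (hmono _ _ (le_max_left m n) hm)
      (hmono _ _ (le_max_right m n) hn)⟩
  · intro i j x hx hy
    obtain ⟨m, hm⟩ := mem_iUnion.1 hx
    obtain ⟨n, hn⟩ := mem_iUnion.1 hy
    exact (h _).antisymm (hmono _ _ (le_max_left m n) hm) (hmono _ _ (le_max_right m n) hn)

theorem IsPreorderFamily.exists_maximal {T : Option ℕ → Option ℕ → Set ℝ}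
    (h : IsPreorderFamily T) :
    ∃ L, IsPreorderFamily L ∧ (∀ u v, T u v ⊆ L u v) ∧
      ∀ M, IsPreorderFamily M → (∀ u v, L u v ⊆ M u v) → ∀ u v, M u v ⊆ L u v := by
  obtain ⟨p, hp⟩ := exists_surjective_nat (Option ℕ × Option ℕ)
  let F : ℕ → Option ℕ → Option ℕ → Set ℝ := Nat.rec T fun n A => Orr.greedyStep (p n) A
  have hF : ∀ n, IsPreorderFamily (F n) := fun n => by
    induction n with
    | zero => exact h
    | succ n ih => exact ih.greedyStep (p n)
  have hmono : ∀ u v, Monotone fun n => F n u v := fun u v =>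
    monotone_nat_of_le_succ fun n => subset_union_left
  refine ⟨fun u v => ⋃ n, F n u v, .iUnion hF hmono,
    fun u v => subset_iUnion (fun n => F n u v) 0, fun M hM hLM u v x hx => ?_⟩
  obtain ⟨n, hn⟩ := hp (u, v)
  have hstep : x ∈ F (n + 1) u v := by
    change x ∈ Orr.greedyStep (p n) (F n) u v
    rw [hn]
    exact (hF n).mem_greedyStep hM
      (fun a b => (subset_iUnion (fun n => F n a b) n).trans (hLM a b)) hx
  exact mem_iUnion.2 ⟨n + 1, hstep⟩

/-- Every extended triangular system can be enlarged to a maximal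
extended triangular system. -/
theorem statement9 (S : ℕ → ℕ → Set ℝ) (R C : ℕ → Set ℝ) (hETS : IsETS S R C) :
    ∃ (S' : ℕ → ℕ → Set ℝ) (R' C' : ℕ → Set ℝ), IsMaxETS S' R' C' ∧
      (∀ i j, S i j ⊆ S' i j) ∧ (∀ i, R i ⊆ R' i) ∧ (∀ j, C j ⊆ C' j) := by
  obtain ⟨L, hL, hTL, hmax⟩ := hETS.isPreorderFamily.exists_maximal
  refine ⟨_, _, _, ⟨hL.isETS, fun S' R' C' h hS hR hC => ?_⟩, fun i j => hTL (some i) (some j),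
    fun i => hTL (some i) none, fun j => hTL none (some j)⟩
  have hle : ∀ u v, L u v ⊆ adjoin S' R' C' u v := by
    rintro (_ | i) (_ | j)
    exacts [(hL.borel _ _).1, hC j, hR i, hS i j]
  have hge := hmax _ h.isPreorderFamily hle
  exact ⟨fun i j => (hge (some i) (some j)).antisymm (hS i j),
    fun i => (hge (some i) none).antisymm (hR i), fun j => (hge none (some j)).antisymm (hC j)⟩

end Orr
end

section
/- Let (A_i)_{i∈ℕ} be a norm-bounded sequence of bounded operators on a complex Hilbert space H such that for each i, ‖A_i A_j*‖ → 0 and ‖A_i* A_j‖ → 0 as j → ∞, and let (S_i)_{i∈ℕ} be a sequence of infinite subsets of ℕ. Then there is an injective map k : ℕ → ℕ with k(i) ∈ S_i for all i such that the series ∑_{i=1}^∞ A_{k(i)} converges in the strong operator topology: for every vector ξ ∈ H, the partial sums ∑_{i=1}^n A_{k(i)} ξ converge in H, and the resulting limit operator is bounded. -/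
open Filter

namespace Orr

variable {H : Type*} [NormedAddCommGroup H] [InnerProductSpace ℂ H] [CompleteSpace H]

/-- A finite family of vectors whose pairwise inner products are dominated by a product weight is
almost orthogonal. -/
theorem norm_sum_sq_le_of_almost_orthogonal {E : Type*} [NormedAddCommGroup E]
    [InnerProductSpace ℂ E] {ι : Type*} [DecidableEq ι] (F : Finset ι)
    (v : ι → E) (w : ι → ℝ) {t : ℝ} (ht : 0 ≤ t)
    (h : ∀ i j, i ≠ j → ‖inner ℂ (v i) (v j)‖ ≤ w i * w j * t) :
    ‖∑ i ∈ F, v i‖ ^ 2 ≤ ∑ i ∈ F, ‖v i‖ ^ 2 + (∑ i ∈ F, w i) ^ 2 * t := by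
  have key : ∀ i j, RCLike.re (inner ℂ (v i) (v j)) ≤
      (if i = j then ‖v i‖ ^ 2 else 0) + w i * w j * t := by
    intro i j
    split_ifs with hij
    · subst hij
      rw [inner_self_eq_norm_sq]
      have := mul_nonneg (mul_self_nonneg (w i)) ht
      linarith
    · have := (RCLike.re_le_norm (inner ℂ (v i) (v j))).trans (h i j hij)
      linarith
  calc ‖∑ i ∈ F, v i‖ ^ 2
      = ∑ i ∈ F, ∑ j ∈ F, RCLike.re (inner ℂ (v i) (v j)) := by
        rw [← inner_self_eq_norm_sq (𝕜 := ℂ), sum_inner, map_sum]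
        simp_rw [inner_sum, map_sum]
    _ ≤ ∑ i ∈ F, ∑ j ∈ F, ((if i = j then ‖v i‖ ^ 2 else 0) + w i * w j * t) :=
        Finset.sum_le_sum fun i _ => Finset.sum_le_sum fun j _ => key i j
    _ = ∑ i ∈ F, ‖v i‖ ^ 2 + (∑ i ∈ F, w i) ^ 2 * t := by
        simp_rw [Finset.sum_add_distrib]
        congr 1
        · refine Finset.sum_congr rfl fun i hi => ?_
          simp [hi]
        · rw [sq, Finset.sum_mul_sum, Finset.sum_mul]
          simp_rw [Finset.sum_mul]

/-- A Bessel inequality for a family of operators with almost orthogonal initial spaces. -/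
theorem sum_norm_sq_apply_le {ι : Type*} [DecidableEq ι] (B : ι → H →L[ℂ] H) {c : ℝ}
    (hc : ∀ i, ‖B i‖ ≤ c) (w : ι → ℝ)
    (h : ∀ i j, i ≠ j → ‖B i * ContinuousLinearMap.adjoint (B j)‖ ≤ w i * w j)
    (F : Finset ι) (ξ : H) :
    ∑ i ∈ F, ‖B i ξ‖ ^ 2 ≤ (c ^ 2 + (∑ i ∈ F, w i) ^ 2) * ‖ξ‖ ^ 2 := by
  rcases F.eq_empty_or_nonempty with rfl | ⟨i₀, -⟩
  · simpa using by positivity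
  have hc0 : 0 ≤ c := (norm_nonneg _).trans (hc i₀)
  set Q := ∑ i ∈ F, ‖B i ξ‖ ^ 2 with hQ
  set W := ∑ i ∈ F, w i
  set v : ι → H := fun i => ContinuousLinearMap.adjoint (B i) (B i ξ) with hv
  have hBξ : ∀ i, ‖B i ξ‖ ≤ c * ‖ξ‖ := fun i => (B i).le_of_opNorm_le (hc i) ξ
  have hinner : ∀ i j, i ≠ j → ‖inner ℂ (v i) (v j)‖ ≤ w i * w j * (c * ‖ξ‖) ^ 2 := by
    intro i j hij
    have e : inner ℂ (v i) (v j) =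
        inner ℂ (B i ξ) ((B i * ContinuousLinearMap.adjoint (B j)) (B j ξ)) := by
      simp only [hv, ContinuousLinearMap.adjoint_inner_left]
      rfl
    have hn := (norm_nonneg _).trans (h i j hij)
    rw [e]
    calc _ ≤ ‖B i ξ‖ * ‖(B i * ContinuousLinearMap.adjoint (B j)) (B j ξ)‖ := norm_inner_le_norm _ _
      _ ≤ (c * ‖ξ‖) * (w i * w j * (c * ‖ξ‖)) := by
        gcongr
        · exact hBξ i
        · exact ((ContinuousLinearMap.le_of_opNorm_le _ (h i j hij) _)).trans
            (mul_le_mul_of_nonneg_left (hBξ j) hn)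
      _ = _ := by ring
  have hX := norm_sum_sq_le_of_almost_orthogonal F v w (sq_nonneg (c * ‖ξ‖)) hinner
  have hvn : ∑ i ∈ F, ‖v i‖ ^ 2 ≤ c ^ 2 * Q := by
    rw [hQ, Finset.mul_sum]
    refine Finset.sum_le_sum fun i _ => ?_
    rw [← mul_pow]
    gcongr
    exact ContinuousLinearMap.le_of_opNorm_le _
      ((LinearIsometryEquiv.norm_map ContinuousLinearMap.adjoint (B i)).le.trans (hc i)) _
  have hQX : Q ≤ ‖∑ i ∈ F, v i‖ * ‖ξ‖ := by
    have : Q = RCLike.re (inner ℂ (∑ i ∈ F, v i) ξ) := by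
      rw [sum_inner, map_sum, hQ]
      refine Finset.sum_congr rfl fun i _ => ?_
      rw [ContinuousLinearMap.adjoint_inner_left, inner_self_eq_norm_sq]
    rw [this]
    exact (RCLike.re_le_norm _).trans (norm_inner_le_norm _ _)
  have hQ0 : 0 ≤ Q := Finset.sum_nonneg fun i _ => sq_nonneg _
  have hQ2 : Q ^ 2 ≤ c ^ 2 * ‖ξ‖ ^ 2 * Q + c ^ 2 * ‖ξ‖ ^ 2 * (W ^ 2 * ‖ξ‖ ^ 2) :=
    calc Q ^ 2 ≤ (‖∑ i ∈ F, v i‖ * ‖ξ‖) ^ 2 := by gcongr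
      _ = ‖∑ i ∈ F, v i‖ ^ 2 * ‖ξ‖ ^ 2 := by ring
      _ ≤ (c ^ 2 * Q + W ^ 2 * (c * ‖ξ‖) ^ 2) * ‖ξ‖ ^ 2 := by
        gcongr
        linarith
      _ = _ := by ring
  have ha : 0 ≤ c ^ 2 * ‖ξ‖ ^ 2 := by positivity
  have hb : 0 ≤ W ^ 2 * ‖ξ‖ ^ 2 := by positivity
  rw [add_mul]
  generalize c ^ 2 * ‖ξ‖ ^ 2 = a at *
  generalize W ^ 2 * ‖ξ‖ ^ 2 = b at *
  by_contra! hlt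
  nlinarith [mul_nonneg hb (by linarith : 0 ≤ Q - a), mul_pos (by linarith : 0 < Q) (sub_pos.2 hlt)]

/-- A family of almost orthogonal operators is pointwise summable. -/
theorem summable_apply_of_almost_orthogonal {ι : Type*} [DecidableEq ι] (B : ι → H →L[ℂ] H) {c : ℝ}
    (hc : ∀ i, ‖B i‖ ≤ c) (w : ι → ℝ) (hw0 : ∀ i, 0 ≤ w i) (hw : Summable w)
    (h1 : ∀ i j, i ≠ j → ‖B i * ContinuousLinearMap.adjoint (B j)‖ ≤ w i * w j)
    (h2 : ∀ i j, i ≠ j → ‖ContinuousLinearMap.adjoint (B i) * B j‖ ≤ w i * w j) (ξ : H) :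
    Summable fun i => B i ξ := by
  have hsq : Summable fun i => ‖B i ξ‖ ^ 2 := by
    refine summable_of_sum_le (c := (c ^ 2 + (∑' i, w i) ^ 2) * ‖ξ‖ ^ 2)
      (fun i => sq_nonneg _) fun F => (sum_norm_sq_apply_le B hc w h1 F ξ).trans ?_
    have := hw.sum_le_tsum F fun i _ => hw0 i
    have := Finset.sum_nonneg fun i (_ : i ∈ F) => hw0 i
    gcongr
  have hwW : ∀ F : Finset ι, ‖∑ i ∈ F, B i ξ‖ ^ 2 ≤
      ∑ i ∈ F, (‖B i ξ‖ ^ 2 + w i * ((∑' i, w i) * ‖ξ‖ ^ 2)) := by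
    intro F
    refine (norm_sum_sq_le_of_almost_orthogonal F (fun i => B i ξ) w (sq_nonneg ‖ξ‖) ?_).trans ?_
    · intro i j hij
      have e : inner ℂ (B i ξ) (B j ξ) =
          inner ℂ ξ ((ContinuousLinearMap.adjoint (B i) * B j) ξ) :=
        (ContinuousLinearMap.adjoint_inner_right _ _ _).symm
      rw [e]
      calc _ ≤ ‖ξ‖ * ‖(ContinuousLinearMap.adjoint (B i) * B j) ξ‖ := norm_inner_le_norm _ _
        _ ≤ ‖ξ‖ * (w i * w j * ‖ξ‖) := by
          gcongr
          exact ContinuousLinearMap.le_of_opNorm_le _ (h2 i j hij) _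
        _ = _ := by ring
    · have := hw.sum_le_tsum F fun i _ => hw0 i
      have := Finset.sum_nonneg fun i (_ : i ∈ F) => hw0 i
      rw [Finset.sum_add_distrib, ← Finset.sum_mul, sq (∑ i ∈ F, w i), mul_assoc]
      gcongr
  rw [summable_iff_vanishing_norm]
  intro ε hε
  obtain ⟨s, hs⟩ := summable_iff_vanishing_norm.1
    (hsq.add (hw.mul_right ((∑' i, w i) * ‖ξ‖ ^ 2))) (ε ^ 2) (by positivity)
  refine ⟨s, fun t ht => lt_of_pow_lt_pow_left₀ 2 hε.le ?_⟩
  exact (hwW t).trans_lt ((le_abs_self _).trans_lt (hs t ht))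

/-- Recursive choice of a sequence, where the `n`-th choice may depend on the finite set of earlier
ones. -/
theorem exists_seq_forall_lt {α : Type*} (P : ℕ → α → Prop) (r : ℕ → α → α → Prop)
    (h : ∀ n (s : Finset α), ∃ y, P n y ∧ ∀ x ∈ s, r n x y) :
    ∃ f : ℕ → α, (∀ n, P n (f n)) ∧ ∀ m n, m < n → r n (f m) (f n) := by
  classical
  choose g hgP hgr using h
  let F : ℕ → Finset α := fun n => Nat.rec ∅ (fun n s => insert (g n s) s) n
  have hF : ∀ n, F (n + 1) = insert (g n (F n)) (F n) := fun n => rfl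
  have hmono : Monotone F := monotone_nat_of_le_succ fun n => by
    rw [hF]
    exact Finset.subset_insert _ _
  refine ⟨fun n => g n (F n), fun n => hgP _ _, fun m n hmn => hgr _ _ _ ?_⟩
  apply hmono (Nat.succ_le_of_lt hmn)
  rw [Nat.succ_eq_add_one, hF]
  exact Finset.mem_insert_self _ _

/-- If `(A_i)` is a bounded sequence with `‖A_i A_j*‖ → 0` and
`‖A_i* A_j‖ → 0` as `j → ∞` for each `i`, and `(S_i)` are infinite subsets of `ℕ`, then
there is an injective `k` with `k(i) ∈ S_i` such that `∑ A_{k(i)}` converges strongly to a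
bounded operator. -/
theorem statement12 (A : ℕ → H →L[ℂ] H) (hbd : ∃ c : ℝ, ∀ i, ‖A i‖ ≤ c)
    (h1 : ∀ i, Tendsto (fun j => ‖A i * ContinuousLinearMap.adjoint (A j)‖) atTop (nhds 0))
    (h2 : ∀ i, Tendsto (fun j => ‖ContinuousLinearMap.adjoint (A i) * A j‖) atTop (nhds 0))
    (S : ℕ → Set ℕ) (hS : ∀ i, (S i).Infinite) :
    ∃ k : ℕ → ℕ, Function.Injective k ∧ (∀ i, k i ∈ S i) ∧
      ∃ D : H →L[ℂ] H, ∀ ξ : H,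
        Tendsto (fun n => (∑ i ∈ Finset.range n, A (k i)) ξ) atTop (nhds (D ξ)) := by
  obtain ⟨c, hc⟩ := hbd
  let w : ℕ → ℝ := fun n => (1 / 2) ^ n
  have hw0 : ∀ n, 0 < w n := fun n => by positivity
  have hwanti : ∀ m n, m < n → w n ≤ w m := fun m n hmn =>
    pow_le_pow_of_le_one (by norm_num) (by norm_num) hmn.le
  obtain ⟨k, hkS, hk⟩ := exists_seq_forall_lt (fun n y => y ∈ S n)
    (fun n x y => x < y ∧ ‖A x * ContinuousLinearMap.adjoint (A y)‖ ≤ w n * w n ∧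
      ‖ContinuousLinearMap.adjoint (A x) * A y‖ ≤ w n * w n) (by
    intro n s
    have hpos := mul_pos (hw0 n) (hw0 n)
    have hev : ∀ᶠ y in atTop, ∀ x ∈ s,
        x < y ∧ ‖A x * ContinuousLinearMap.adjoint (A y)‖ ≤ w n * w n ∧
          ‖ContinuousLinearMap.adjoint (A x) * A y‖ ≤ w n * w n :=
      (Filter.eventually_all_finset s).2 fun x _ => (eventually_gt_atTop x).and
        (((h1 x).eventually_le_const hpos).and ((h2 x).eventually_le_const hpos))
    exact ((Nat.frequently_atTop_iff_infinite.2 (hS n)).and_eventually hev).exists)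
  have hkmono : StrictMono k := fun m n hmn => (hk m n hmn).1
  have hww : ∀ m n, m < n → w n * w n ≤ w m * w n := fun m n hmn =>
    mul_le_mul_of_nonneg_right (hwanti m n hmn) (hw0 n).le
  have hs := summable_apply_of_almost_orthogonal (fun i => A (k i)) (fun i => hc (k i)) w
    (fun n => (hw0 n).le) summable_geometric_two
    (by
      intro i j hij
      rcases hij.lt_or_gt with hlt | hlt
      · exact (hk i j hlt).2.1.trans (hww i j hlt)
      · rw [← norm_star, star_mul, ← ContinuousLinearMap.star_eq_adjoint, star_star,
          ContinuousLinearMap.star_eq_adjoint, mul_comm (w i)]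
        exact (hk j i hlt).2.1.trans (hww j i hlt))
    (by
      intro i j hij
      rcases hij.lt_or_gt with hlt | hlt
      · exact (hk i j hlt).2.2.trans (hww i j hlt)
      · rw [← norm_star, star_mul, ← ContinuousLinearMap.star_eq_adjoint, star_star,
          ContinuousLinearMap.star_eq_adjoint, mul_comm (w i)]
        exact (hk j i hlt).2.2.trans (hww j i hlt))
  refine ⟨k, hkmono.injective, hkS, ?_⟩
  have hlim : ∀ ξ : H, Tendsto (fun n => (∑ i ∈ Finset.range n, A (k i)) ξ) atTop
      (nhds (∑' i, A (k i) ξ)) := fun ξ => by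
    simpa only [_root_.sum_apply] using (hs ξ).hasSum.tendsto_sum_nat
  exact ⟨continuousLinearMapOfTendsto (σ₁₂ := RingHom.id ℂ)
    (fun n => ∑ i ∈ Finset.range n, A (k i)) (tendsto_pi_nhds.2 hlim), hlim⟩

end Orr
end

section
/- Let H be a complex Hilbert space, a > 0, and let (A_i), (B_i), (D_i) be sequences in B(H) with ‖A_i D_i B_i‖ > a for all i. Suppose (A_i) converges to 0 in the strong operator topology, (B_i) is norm-bounded, and each D_i is compact with D_i → 0 and D_i* → 0 in the strong operator topology. Then for every ε > 0 and every sequence (S_i) of infinite subsets of ℕ there is an injective map k : ℕ → ℕ with k(i) ∈ S_i for all i, such that the series ∑_{i=1}^∞ D_{k(i)} converges in the strong operator topology to a bounded operator D, and ‖A_{k(i)} D B_{k(i)}‖ > (1 − ε) a for all i ∈ ℕ. -/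
open Filter

namespace Orr

variable {H : Type*} [NormedAddCommGroup H] [InnerProductSpace ℂ H] [CompleteSpace H]

/-- A strongly convergent sequence of operators is norm bounded. -/
lemma exists_norm_le_of_strong_tendsto {T : ℕ → H →L[ℂ] H}
    (hT : ∀ ξ : H, Tendsto (fun n => T n ξ) atTop (nhds 0)) :
    ∃ C : ℝ, 0 < C ∧ ∀ n, ‖T n‖ ≤ C := by
  obtain ⟨C, hC⟩ := banach_steinhaus (g := T) fun x => by
    obtain ⟨C, hC⟩ := (Metric.isBounded_range_of_tendsto _ (hT x)).exists_norm_le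
    exact ⟨C, fun i => hC _ ⟨i, rfl⟩⟩
  exact ⟨max C 1, by positivity, fun n => (hC n).trans (le_max_left _ _)⟩

/-- Composing with a compact operator on the right turns strong convergence to zero into
norm convergence to zero. -/
lemma tendsto_norm_mul_of_isCompactOperator {T : ℕ → H →L[ℂ] H} {K : H →L[ℂ] H}
    (hT : ∀ ξ : H, Tendsto (fun n => T n ξ) atTop (nhds 0)) (hK : IsCompactOperator K) :
    Tendsto (fun n => ‖T n * K‖) atTop (nhds 0) := by
  obtain ⟨C, hC0, hC⟩ := exists_norm_le_of_strong_tendsto hT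
  obtain ⟨Q, hQ, hKQ⟩ := hK.image_closedBall_subset_compact (f := (K : H →ₗ[ℂ] H)) 1
  rw [Metric.tendsto_nhds]
  intro e he
  obtain ⟨t, -, htfin, ht⟩ := hQ.finite_cover_balls (e := e / (4 * C)) (by positivity)
  have hev : ∀ᶠ n in atTop, ∀ c ∈ t, ‖T n c‖ < e / 4 := by
    rw [eventually_all_finite htfin]
    intro c _
    have := (hT c).norm
    rw [norm_zero] at this
    exact this.eventually_lt_const (by positivity)
  filter_upwards [hev] with n hn
  have hle : ‖T n * K‖ ≤ e / 2 := by
    refine ContinuousLinearMap.opNorm_le_of_unit_norm (by positivity) fun x hx => ?_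
    have hxQ : K x ∈ Q := hKQ ⟨x, by simp [hx], rfl⟩
    obtain ⟨c, hc, hxc⟩ := Set.mem_iUnion₂.1 (ht hxQ)
    rw [Metric.mem_ball, dist_eq_norm] at hxc
    have h1 : ‖T n (K x - c)‖ ≤ e / 4 := by
      calc ‖T n (K x - c)‖ ≤ C * (e / (4 * C)) := (T n).le_of_opNorm_le_of_le (hC n) hxc.le
        _ = e / 4 := by field_simp
    calc ‖(T n * K) x‖ = ‖T n (K x - c) + T n c‖ := by simp
      _ ≤ ‖T n (K x - c)‖ + ‖T n c‖ := norm_add_le _ _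
      _ ≤ e / 2 := by linarith [hn c hc]
  rw [Real.dist_eq, sub_zero, abs_of_nonneg (norm_nonneg _)]
  linarith

/-- Almost orthogonal vectors satisfy an approximate Pythagorean inequality. -/
lemma norm_sum_sq_le_of_norm_inner_le {E : Type*} [NormedAddCommGroup E]
    [InnerProductSpace ℂ E] (x : ℕ → E) (w : ℕ → ℝ)
    (hx : ∀ i j, i < j → ‖inner ℂ (x i) (x j)‖ ≤ w i * w j) (F : Finset ℕ) :
    ‖∑ i ∈ F, x i‖ ^ 2 ≤ ∑ i ∈ F, ‖x i‖ ^ 2 + (∑ i ∈ F, w i) ^ 2 := by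
  have hterm (i j : ℕ) :
      RCLike.re (inner ℂ (x i) (x j)) ≤ (if i = j then ‖x i‖ ^ 2 else 0) + w i * w j := by
    rcases lt_trichotomy i j with h | h | h
    · rw [if_neg h.ne, zero_add]
      exact (RCLike.re_le_norm _).trans (hx i j h)
    · subst h
      rw [if_pos rfl, inner_self_eq_norm_sq (𝕜 := ℂ)]
      exact le_add_of_nonneg_right (mul_self_nonneg _)
    · rw [if_neg h.ne', zero_add, mul_comm]
      refine (RCLike.re_le_norm _).trans ?_
      rw [norm_inner_symm]
      exact hx j i h
  calc ‖∑ i ∈ F, x i‖ ^ 2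
      = ∑ i ∈ F, ∑ j ∈ F, RCLike.re (inner ℂ (x i) (x j)) := by
        rw [← inner_self_eq_norm_sq (𝕜 := ℂ), sum_inner, map_sum]
        simp only [inner_sum, map_sum]
    _ ≤ ∑ i ∈ F, ∑ j ∈ F, ((if i = j then ‖x i‖ ^ 2 else 0) + w i * w j) :=
        Finset.sum_le_sum fun i _ => Finset.sum_le_sum fun j _ => hterm i j
    _ = ∑ i ∈ F, ‖x i‖ ^ 2 + (∑ i ∈ F, w i) ^ 2 := by
        simp only [Finset.sum_add_distrib, Finset.sum_ite_eq]
        rw [sq (∑ i ∈ F, w i), Finset.sum_mul_sum]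
        congr 1
        exact Finset.sum_congr rfl fun i hi => if_pos hi

/-- A uniformly bounded sequence of operators with almost orthogonal ranges and almost orthogonal
supports is strongly summable. -/
lemma summable_apply_of_almost_orthogonal_s13 (D : ℕ → H →L[ℂ] H) (w : ℕ → ℝ) (M : ℝ)
    (hw : ∀ i, 0 ≤ w i) (hwsum : Summable w) (hM : ∀ i, ‖D i‖ ≤ M)
    (hrange : ∀ i j, i < j → ‖ContinuousLinearMap.adjoint (D j) * D i‖ ≤ w i * w j)
    (hsupp : ∀ i j, i < j → ‖(ContinuousLinearMap.adjoint (D j) * D j) *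
      (ContinuousLinearMap.adjoint (D i) * D i)‖ ≤ w i * w j) (ξ : H) :
    Summable fun i => D i ξ := by
  have hM0 : 0 ≤ M := (norm_nonneg _).trans (hM 0)
  set P : ℕ → H →L[ℂ] H := fun i => ContinuousLinearMap.adjoint (D i) * D i with hP
  have hPinner (i : ℕ) (x y : H) : inner ℂ (P i x) y = inner ℂ (D i x) (D i y) := by
    simp [hP, ContinuousLinearMap.adjoint_inner_left]
  have hPself (i : ℕ) (x y : H) : inner ℂ x (P i y) = inner ℂ (P i x) y := by
    rw [hPinner]
    simp [hP, ContinuousLinearMap.adjoint_inner_right]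
  have hDin (i j : ℕ) (hij : i < j) :
      ‖inner ℂ (D i ξ) (D j ξ)‖ ≤ (w i * ‖ξ‖) * (w j * ‖ξ‖) := by
    rw [← ContinuousLinearMap.adjoint_inner_left]
    calc _ ≤ ‖(ContinuousLinearMap.adjoint (D j) * D i) ξ‖ * ‖ξ‖ := norm_inner_le_norm _ _
      _ ≤ (w i * w j * ‖ξ‖) * ‖ξ‖ := by
        gcongr
        exact ContinuousLinearMap.le_of_opNorm_le _ (hrange i j hij) _
      _ = _ := by ring
  have hPin (i j : ℕ) (hij : i < j) :
      ‖inner ℂ (P i ξ) (P j ξ)‖ ≤ (w i * ‖ξ‖) * (w j * ‖ξ‖) := by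
    rw [hPself]
    calc _ ≤ ‖(P j * P i) ξ‖ * ‖ξ‖ := norm_inner_le_norm _ _
      _ ≤ (w i * w j * ‖ξ‖) * ‖ξ‖ := by
        gcongr
        exact ContinuousLinearMap.le_of_opNorm_le _ (hsupp i j hij) _
      _ = _ := by ring
  have hPnorm (i : ℕ) : ‖P i ξ‖ ≤ M * ‖D i ξ‖ := by
    refine ContinuousLinearMap.le_of_opNorm_le (ContinuousLinearMap.adjoint (D i)) ?_ (D i ξ)
    rw [LinearIsometryEquiv.norm_map]
    exact hM i
  set W : ℝ := (∑' i, w i * ‖ξ‖)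
  have hwξ : Summable fun i => w i * ‖ξ‖ := hwsum.mul_right _
  have hwξ0 (i : ℕ) : 0 ≤ w i * ‖ξ‖ := mul_nonneg (hw i) (norm_nonneg _)
  have hbound (F : Finset ℕ) :
      ∑ i ∈ F, ‖D i ξ‖ ^ 2 ≤ (M * ‖ξ‖) ^ 2 + ‖ξ‖ * W := by
    set X := ∑ i ∈ F, ‖D i ξ‖ ^ 2 with hX
    have hX0 : 0 ≤ X := Finset.sum_nonneg fun i _ => sq_nonneg _
    have hW0 : 0 ≤ W := tsum_nonneg hwξ0
    have hXle : X ≤ ‖∑ i ∈ F, P i ξ‖ * ‖ξ‖ := by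
      calc X = RCLike.re (inner ℂ (∑ i ∈ F, P i ξ) ξ) := by
            rw [sum_inner, map_sum]
            refine Finset.sum_congr rfl fun i _ => ?_
            rw [hPinner, inner_self_eq_norm_sq (𝕜 := ℂ)]
        _ ≤ _ := (RCLike.re_le_norm _).trans (norm_inner_le_norm _ _)
    have hV : ‖∑ i ∈ F, P i ξ‖ ^ 2 ≤ M ^ 2 * X + W ^ 2 := by
      refine (norm_sum_sq_le_of_norm_inner_le _ _ hPin F).trans ?_
      gcongr
      · rw [hX, Finset.mul_sum]
        refine Finset.sum_le_sum fun i _ => ?_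
        rw [← mul_pow]
        gcongr
        exact hPnorm i
      · exact Finset.sum_nonneg fun i _ => hwξ0 i
      · exact hwξ.sum_le_tsum F fun i _ => hwξ0 i
    have hsq : X ^ 2 ≤ (M * ‖ξ‖) ^ 2 * X + (‖ξ‖ * W) ^ 2 := by
      calc X ^ 2 ≤ (‖∑ i ∈ F, P i ξ‖ * ‖ξ‖) ^ 2 := by gcongr
        _ = ‖∑ i ∈ F, P i ξ‖ ^ 2 * ‖ξ‖ ^ 2 := by ring
        _ ≤ (M ^ 2 * X + W ^ 2) * ‖ξ‖ ^ 2 := by gcongr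
        _ = _ := by ring
    have hξW : 0 ≤ ‖ξ‖ * W := by positivity
    by_contra! hlt
    nlinarith [sq_nonneg (M * ‖ξ‖)]
  have hsqsum : Summable fun i => ‖D i ξ‖ ^ 2 :=
    summable_of_sum_le (fun i => sq_nonneg _) hbound
  rw [summable_iff_vanishing_norm]
  intro e he
  obtain ⟨s₁, hs₁⟩ := summable_iff_vanishing_norm.1 hsqsum (e ^ 2 / 2) (by positivity)
  obtain ⟨s₂, hs₂⟩ := summable_iff_vanishing_norm.1 hwξ (e / 2) (by positivity)
  refine ⟨s₁ ∪ s₂, fun t ht => ?_⟩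
  rw [Finset.disjoint_union_right] at ht
  have h1 := (le_abs_self _).trans_lt (hs₁ t ht.1)
  have h2 := hs₂ t ht.2
  rw [Real.norm_of_nonneg (Finset.sum_nonneg fun i _ => hwξ0 i)] at h2
  have h3 := norm_sum_sq_le_of_norm_inner_le _ _ hDin t
  have h4 : 0 ≤ ∑ i ∈ t, w i * ‖ξ‖ := Finset.sum_nonneg fun i _ => hwξ0 i
  refine lt_of_pow_lt_pow_left₀ 2 he.le ?_
  nlinarith

/-- Diagonal selection from infinite sets: relations that hold eventually in the last variable
can be arranged to hold for all pairs of terms of a sequence. -/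
lemma exists_seq_mem_of_eventually (S : ℕ → Set ℕ) (hS : ∀ i, (S i).Infinite)
    (R : ℕ → ℕ → ℕ → ℕ → Prop) (hR : ∀ i j m, ∀ᶠ n in atTop, R i j m n) :
    ∃ k : ℕ → ℕ, (∀ i, k i ∈ S i) ∧ ∀ i j, i < j → R i j (k i) (k j) := by
  have hstep (j : ℕ) (f : ∀ i, i < j → ℕ) :
      ∃ n, n ∈ S j ∧ ∀ i (hi : i < j), R i j (f i hi) n := by
    have hev : ∀ᶠ n in atTop, ∀ i : Fin j, R i j (f i i.2) n :=
      eventually_all.2 fun i => hR _ _ _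
    obtain ⟨n, hn, hnS⟩ :=
      (hev.and_frequently (Nat.frequently_atTop_iff_infinite.2 (hS j))).exists
    exact ⟨n, hnS, fun i hi => hn ⟨i, hi⟩⟩
  choose g hgS hgR using hstep
  set k : ℕ → ℕ := (wellFounded_lt (α := ℕ)).fix g
  have hk (j : ℕ) : k j = g j fun i _ => k i := WellFounded.fix_eq _ _ _
  refine ⟨k, fun i => ?_, fun i j hij => ?_⟩
  · rw [hk]
    exact hgS _ _
  · rw [hk j]
    exact hgR j (fun i _ => k i) i hij

/-- Given `‖A_i D_i B_i‖ > a` with `A_i → 0` strongly, `(B_i)` bounded,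
and `D_i` compact with `D_i, D_i* → 0` strongly, for every `ε > 0` and infinite sets `S_i`
there is an injective `k` with `k(i) ∈ S_i` such that `D = ∑ D_{k(i)}` converges strongly
and `‖A_{k(i)} D B_{k(i)}‖ > (1-ε)a` for all `i`. -/
theorem statement13 (a : ℝ) (ha : 0 < a) (A B D : ℕ → H →L[ℂ] H)
    (hABD : ∀ i, a < ‖A i * D i * B i‖)
    (hA : ∀ ξ : H, Tendsto (fun i => A i ξ) atTop (nhds 0))
    (hB : ∃ c : ℝ, ∀ i, ‖B i‖ ≤ c)
    (hDcpt : ∀ i, IsCompactOperator (D i))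
    (hD : ∀ ξ : H, Tendsto (fun i => D i ξ) atTop (nhds 0))
    (hDstar : ∀ ξ : H, Tendsto (fun i => ContinuousLinearMap.adjoint (D i) ξ) atTop (nhds 0))
    (ε : ℝ) (hε : 0 < ε) (S : ℕ → Set ℕ) (hS : ∀ i, (S i).Infinite) :
    ∃ k : ℕ → ℕ, Function.Injective k ∧ (∀ i, k i ∈ S i) ∧
      ∃ Dop : H →L[ℂ] H,
        (∀ ξ : H, Tendsto (fun n => (∑ i ∈ Finset.range n, D (k i)) ξ) atTop (nhds (Dop ξ))) ∧
        ∀ i, (1 - ε) * a < ‖A (k i) * Dop * B (k i)‖ := by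
  obtain ⟨c, hc⟩ := hB
  obtain ⟨M, hM0, hM⟩ := exists_norm_le_of_strong_tendsto hD
  choose ξ hξ hξa using fun i =>
    (A i * D i * B i).exists_lt_apply_of_lt_opNorm (hABD i)
  set η : ℝ := √(ε * a / 2)
  have hη0 : 0 < η := by positivity
  have hη2 : η ^ 2 = ε * a / 2 := Real.sq_sqrt (by positivity)
  set w : ℕ → ℝ := fun i => η * (1 / 2) ^ i
  have hw0 (i : ℕ) : 0 < w i := by positivity
  have hwη (i : ℕ) : w i ≤ η :=
    mul_le_of_le_one_right hη0.le (pow_le_one₀ (by norm_num) (by norm_num))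
  have hwsum : HasSum w (η * 2) := hasSum_geometric_two.mul_left η
  set P : ℕ → H →L[ℂ] H := fun i => ContinuousLinearMap.adjoint (D i) * D i with hP
  have hPtendsto (x : H) : Tendsto (fun i => P i x) atTop (nhds 0) := by
    refine squeeze_zero_norm (a := fun i => M * ‖D i x‖) (fun i => ?_) ?_
    · refine ContinuousLinearMap.le_of_opNorm_le (ContinuousLinearMap.adjoint (D i)) ?_ (D i x)
      rw [LinearIsometryEquiv.norm_map]
      exact hM i
    · simpa using (hD x).norm.const_mul M
  have hPcpt (i : ℕ) : IsCompactOperator (P i) :=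
    (hDcpt i).clm_comp (ContinuousLinearMap.adjoint (D i))
  obtain ⟨k, hkS, hk⟩ := exists_seq_mem_of_eventually S hS
    (fun i j m n => m < n ∧ ‖P n * P m‖ ≤ w i * w j ∧
      ‖ContinuousLinearMap.adjoint (D n) * D m‖ ≤ w i * w j ∧
      ‖A n * D m‖ * c ≤ w i * w j ∧ ‖A m (D n (B m (ξ m)))‖ ≤ w i * w j) (by
    intro i j m
    have hpos : 0 < w i * w j := mul_pos (hw0 i) (hw0 j)
    have hAD := (tendsto_norm_mul_of_isCompactOperator hA (hDcpt m)).mul_const c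
    rw [zero_mul] at hAD
    have hADB := (((A m).continuous.tendsto 0).comp (hD (B m (ξ m)))).norm
    rw [map_zero, norm_zero] at hADB
    exact (eventually_gt_atTop m).and <|
      ((tendsto_norm_mul_of_isCompactOperator hPtendsto (hPcpt m)).eventually_le_const hpos).and <|
      ((tendsto_norm_mul_of_isCompactOperator hDstar (hDcpt m)).eventually_le_const hpos).and <|
      (hAD.eventually_le_const hpos).and (hADB.eventually_le_const hpos))
  have hsum (x : H) : Summable fun i => D (k i) x :=
    summable_apply_of_almost_orthogonal_s13 (fun i => D (k i)) w M (fun i => (hw0 i).le)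
      hwsum.summable (fun i => hM _) (fun i j hij => (hk i j hij).2.2.1)
      (fun i j hij => (hk i j hij).2.1) x
  have hlim : Tendsto (fun n x => (∑ i ∈ Finset.range n, D (k i)) x) atTop
      (nhds fun x => ∑' i, D (k i) x) := by
    rw [tendsto_pi_nhds]
    intro x
    simpa using (hsum x).hasSum.tendsto_sum_nat
  set Dop : H →L[ℂ] H :=
    continuousLinearMapOfTendsto (fun n => ∑ i ∈ Finset.range n, D (k i)) hlim
  have hDop (x : H) : HasSum (fun i => D (k i) x) (Dop x) := (hsum x).hasSum
  have hkmono : StrictMono k := fun i j hij => (hk i j hij).1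
  refine ⟨k, hkmono.injective, hkS, Dop, fun x => tendsto_pi_nhds.1 hlim x, fun i => ?_⟩
  set y : ℕ → H := fun j => A (k i) (D (k j) (B (k i) (ξ (k i))))
  set Y : H := A (k i) (Dop (B (k i) (ξ (k i))))
  have hyY : HasSum y Y := (A (k i)).hasSum (hDop _)
  have hoff (j : ℕ) : ‖Function.update y i 0 j‖ ≤ w i * w j := by
    rcases lt_trichotomy j i with h | h | h
    · rw [Function.update_of_ne h.ne]
      obtain ⟨-, -, -, h4, -⟩ := hk j i h
      have hBξ : ‖B (k i) (ξ (k i))‖ ≤ c := by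
        simpa using (B (k i)).le_of_opNorm_le_of_le (hc (k i)) (hξ (k i)).le
      calc ‖y j‖ ≤ ‖A (k i) * D (k j)‖ * c :=
            (A (k i) * D (k j)).le_opNorm_of_le hBξ
        _ ≤ w j * w i := h4
        _ = w i * w j := mul_comm _ _
    · subst h
      rw [Function.update_self, norm_zero]
      exact (mul_pos (hw0 _) (hw0 _)).le
    · rw [Function.update_of_ne h.ne']
      exact (hk i j h).2.2.2.2
  have hdiff : ‖0 - y i + Y‖ ≤ w i * (η * 2) :=
    (hyY.update i 0).norm_le_of_bounded (hwsum.mul_left (w i)) hoff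
  have hsmall : w i * (η * 2) ≤ ε * a := by nlinarith [hwη i]
  have hyi : a < ‖y i‖ := hξa (k i)
  have htri : ‖y i‖ ≤ ‖Y‖ + ‖0 - y i + Y‖ := by
    calc ‖y i‖ = ‖Y - (0 - y i + Y)‖ := by congr 1; abel
      _ ≤ _ := norm_sub_le _ _
  have hYle : ‖Y‖ ≤ ‖A (k i) * Dop * B (k i)‖ :=
    (A (k i) * Dop * B (k i)).unit_le_opNorm _ (hξ (k i)).le
  linarith

end Orr
end
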